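/- Let p be a prime, n ≥ 2 an integer, and d ≥ n an integer. Let f ∈ ℤ[X] be a nonzero polynomial of degree d with ‖f‖_∞ ≤ F for a real F ≥ 1, and let r̂ ∈ ℤ[X] be a nonzero polynomial with deg r̂ ≤ d − 1 and ‖r̂‖_∞ ≤ C · p^{(n−1)/d} for a real C ≥ 1. Then |Res(f, r̂)| ≤ (2d − 1)! · F^{d−1} · C^{d} · p^{n−1}. In particular, writing Q = p^n, the resultant is at most (2d−1)!·F^{d−1}·C^{d} · Q^{1 − 1/n}. -/

import Mathlib

open Polynomial

/-- The Sylvester matrix of two integer polynomials `f` and `g`: the square matrix of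
size `(deg f) + (deg g)` whose first `deg g` rows contain the shifted coefficients of
`f` and whose remaining `deg f` rows contain the shifted coefficients of `g`. -/
def sylvester (f g : Polynomial ℤ) :
    Matrix (Fin (f.natDegree + g.natDegree)) (Fin (f.natDegree + g.natDegree)) ℤ :=
  Matrix.of fun i j =>
    if (i : ℕ) < g.natDegree then
      if (i : ℕ) ≤ (j : ℕ) then f.coeff ((j : ℕ) - (i : ℕ)) else 0
    else
      if (i : ℕ) - g.natDegree ≤ (j : ℕ) then
        g.coeff ((j : ℕ) - ((i : ℕ) - g.natDegree))
      else 0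

/-- The resultant of two integer polynomials: the determinant of their Sylvester
matrix. -/
def resultant (f g : Polynomial ℤ) : ℤ := (_root_.sylvester f g).det

/-- A determinant whose `i`-th row is bounded by `b i` is at most the number of permutations
times the product of the row bounds. -/
theorem abs_det_le_factorial_mul_prod {ι : Type*} [Fintype ι] [DecidableEq ι]
    (A : Matrix ι ι ℤ) (b : ι → ℝ) (hA : ∀ i j, |(A i j : ℝ)| ≤ b i) :
    |(A.det : ℝ)| ≤ (Nat.factorial (Fintype.card ι) : ℝ) * ∏ i, b i := by
  rw [Matrix.det_apply']
  push_cast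
  calc _ ≤ ∑ σ : Equiv.Perm ι, |((Equiv.Perm.sign σ : ℤ) : ℝ) * ∏ i, (A (σ i) i : ℝ)| :=
        Finset.abs_sum_le_sum_abs _ _
    _ ≤ ∑ _σ : Equiv.Perm ι, ∏ i, b i := by
        refine Finset.sum_le_sum fun σ _ => ?_
        have hsign : |((Equiv.Perm.sign σ : ℤ) : ℝ)| = 1 := by
          rcases Int.units_eq_one_or (Equiv.Perm.sign σ) with h | h <;> simp [h]
        rw [abs_mul, hsign, one_mul, Finset.abs_prod, ← Equiv.prod_comp σ b]
        exact Finset.prod_le_prod (fun _ _ => abs_nonneg _) fun i _ => hA _ _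
    _ = _ := by simp [Fintype.card_perm]

/-- The resultant is bounded in terms of coefficient bounds of the two polynomials. -/
theorem abs_resultant_le (f g : Polynomial ℤ) (F B : ℝ)
    (hf : ∀ i, |(f.coeff i : ℝ)| ≤ F) (hg : ∀ i, |(g.coeff i : ℝ)| ≤ B) :
    |(_root_.resultant f g : ℝ)| ≤ (Nat.factorial (f.natDegree + g.natDegree) : ℝ) *
      (F ^ g.natDegree * B ^ f.natDegree) := by
  have hF : 0 ≤ F := (abs_nonneg _).trans (hf 0)
  have hB : 0 ≤ B := (abs_nonneg _).trans (hg 0)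
  have hdet := abs_det_le_factorial_mul_prod (_root_.sylvester f g)
    (fun i => if (i : ℕ) < g.natDegree then F else B) (by
      intro i j
      simp only [_root_.sylvester, Matrix.of_apply]
      split_ifs <;> simp [hf, hg, hF, hB])
  have hprod : ∏ i : Fin (f.natDegree + g.natDegree),
      (if (i : ℕ) < g.natDegree then F else B) = F ^ g.natDegree * B ^ f.natDegree := by
    rw [Fin.prod_univ_eq_prod_range (fun i => if i < g.natDegree then F else B), add_comm,
      Finset.prod_range_add, Finset.prod_congr rfl fun i hi => if_pos (Finset.mem_range.1 hi)]
    simp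
  rwa [hprod, Fintype.card_fin] at hdet

/-- Norm bound for the reduced preimage with the gJL / Conjugation polynomial
selections: if `deg f = d`, `‖f‖_∞ ≤ F`, `deg r̂ ≤ d − 1` and
`‖r̂‖_∞ ≤ C·p^((n−1)/d)`, then `|Res(f, r̂)| ≤ (2d−1)!·F^(d−1)·C^d·p^(n−1)`,
i.e. the norm of the preimage is `O(Q^(1−1/n))` where `Q = p^n`. -/
theorem stmt11 (p : ℕ) (hp : p.Prime) (n d : ℕ) (hn : 2 ≤ n) (hnd : n ≤ d)
    (f : Polynomial ℤ) (hf0 : f ≠ 0) (hfdeg : f.natDegree = d)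
    (F : ℝ) (hF : 1 ≤ F) (hfc : ∀ i, (|f.coeff i| : ℝ) ≤ F)
    (r : Polynomial ℤ) (hr0 : r ≠ 0) (hrdeg : r.natDegree ≤ d - 1)
    (C : ℝ) (hC : 1 ≤ C)
    (hrc : ∀ i, (|r.coeff i| : ℝ) ≤ C * (p : ℝ) ^ (((n : ℝ) - 1) / (d : ℝ))) :
    (|_root_.resultant f r| : ℝ) ≤
        (Nat.factorial (2 * d - 1) : ℝ) * F ^ (d - 1) * C ^ d * (p : ℝ) ^ (n - 1) ∧
      (|_root_.resultant f r| : ℝ) ≤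
        (Nat.factorial (2 * d - 1) : ℝ) * F ^ (d - 1) * C ^ d
          * ((p : ℝ) ^ n) ^ (1 - 1 / (n : ℝ)) := by
  have hn0 : (n : ℝ) ≠ 0 := by positivity
  have hd0 : (d : ℝ) ≠ 0 := by
    have : d ≠ 0 := by omega
    exact_mod_cast this
  have hcast : ((n - 1 : ℕ) : ℝ) = (n : ℝ) - 1 := by
    rw [Nat.cast_sub (by omega), Nat.cast_one]
  have hp0 : (0 : ℝ) ≤ p := p.cast_nonneg
  have hpow : ((p : ℝ) ^ (((n : ℝ) - 1) / (d : ℝ))) ^ d = (p : ℝ) ^ (n - 1) := by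
    rw [← Real.rpow_mul_natCast hp0, div_mul_cancel₀ _ hd0, ← hcast, Real.rpow_natCast]
  have hQ : ((p : ℝ) ^ n) ^ (1 - 1 / (n : ℝ)) = (p : ℝ) ^ (n - 1) := by
    rw [← Real.rpow_natCast_mul hp0, mul_sub, mul_one, mul_one_div_cancel hn0, ← hcast,
      Real.rpow_natCast]
  rw [hQ, and_self]
  have hres := abs_resultant_le f r F _ hfc hrc
  rw [hfdeg, mul_pow, hpow] at hres
  calc _ ≤ _ := hres
    _ ≤ (Nat.factorial (2 * d - 1) : ℝ) * (F ^ (d - 1) * (C ^ d * (p : ℝ) ^ (n - 1))) := by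
        have hfact : d + r.natDegree ≤ 2 * d - 1 := by omega
        gcongr
    _ = _ := by ring
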